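/- Let N, K be positive integers, c_K = N/K, let ρ̂_1, …, ρ̂_N be pairwise distinct positive real numbers, and let 𝒩 be a nonempty subset of {1,…,N}. Let C be the positively oriented circle of real center x₀ and radius R > 0, and assume |ρ̂_k − x₀| < R for every k ∈ 𝒩 and |ρ̂_i − x₀| > R for every i ∉ 𝒩. Define ĝ(z) = −((1/N) Σ_{i=1}^N z/(ρ̂_i − z)) · (1 − c_K + (c_K/N) Σ_{r=1}^N (ρ̂_r/(ρ̂_r − z))²). Then (N/(2πi)) ∮_C ĝ(z) dz = Σ_{k ∈ 𝒩} ρ̂_k (1 − c_K − (c_K/N) Σ_{i ≠ k} ρ̂_i/(ρ̂_k − ρ̂_i)). -/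

import Mathlib

open scoped Real

open Metric

/-- The Cauchy kernel integrates to zero over a circle that does not enclose its pole. -/
lemma circleIntegral_sub_inv_of_notMem_closedBall {c w : ℂ} {R : ℝ} (hR : 0 ≤ R)
    (hw : w ∉ closedBall c R) : (∮ z in C(c, R), (z - w)⁻¹) = 0 := by
  have hne : ∀ z ∈ closedBall c R, z - w ≠ 0 := fun z hz h =>
    hw (sub_eq_zero.mp h ▸ hz)
  refine Complex.circleIntegral_eq_zero_of_differentiable_on_off_countable hR
    Set.countable_empty ?_ ?_
  · exact (continuousOn_id.sub continuousOn_const).inv₀ hne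
  · rintro z ⟨hz, -⟩
    exact (differentiableAt_id.sub_const w).inv (hne z (ball_subset_closedBall hz))

lemma continuousOn_sphere_sub_inv {c w : ℂ} {R : ℝ} (hw : w ∉ sphere c R) :
    ContinuousOn (fun z : ℂ => (z - w)⁻¹) (sphere c R) :=
  (continuousOn_id.sub continuousOn_const).inv₀ fun z hz (h : z - w = 0) =>
    hw (sub_eq_zero.mp h ▸ hz)

lemma circleIntegral_sub_inv_pow_of_two_le (c w : ℂ) (R : ℝ) {n : ℕ} (hn : 2 ≤ n) :
    (∮ z in C(c, R), ((z - w)⁻¹) ^ n) = 0 := by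
  have h := circleIntegral.integral_sub_zpow_of_ne (n := -(n : ℤ)) (by lia) c w R
  simpa [zpow_neg, inv_pow] using h

lemma circleIntegral_const_eq_zero (c a : ℂ) {R : ℝ} (hR : 0 ≤ R) :
    (∮ _z in C(c, R), a) = 0 :=
  Complex.circleIntegral_eq_zero_of_differentiable_on_off_countable hR
    Set.countable_empty continuousOn_const fun _ _ => differentiableAt_const a

/-- The integral of a simple pole plus a constant. -/
lemma circleIntegral_one_add_mul_sub_inv {c a : ℂ} {R : ℝ} (hR : 0 ≤ R)
    (ha : a ∉ sphere c R) :
    (∮ z in C(c, R), (1 + a * (z - a)⁻¹)) = a * ∮ z in C(c, R), (z - a)⁻¹ := by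
  have hca := continuousOn_sphere_sub_inv ha
  rw [circleIntegral.integral_add, circleIntegral_const_eq_zero c 1 hR, zero_add,
    circleIntegral.integral_const_mul]
  · exact continuousOn_const.circleIntegrable hR
  · exact (continuousOn_const.mul hca).circleIntegrable hR

/-- A simple pole at `a` times a double pole at the same point has no residue. -/
lemma circleIntegral_one_add_mul_sub_inv_mul_sq_self {c a : ℂ} {R : ℝ} (hR : 0 ≤ R)
    (ha : a ∉ sphere c R) :
    (∮ z in C(c, R), (1 + a * (z - a)⁻¹) * (a * (z - a)⁻¹) ^ 2) = 0 := by
  have hca := continuousOn_sphere_sub_inv ha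
  have hexp : ∀ z : ℂ, (1 + a * (z - a)⁻¹) * (a * (z - a)⁻¹) ^ 2 =
      a ^ 2 * ((z - a)⁻¹) ^ 2 + a ^ 3 * ((z - a)⁻¹) ^ 3 := fun z => by ring
  simp_rw [hexp]
  rw [circleIntegral.integral_add, circleIntegral.integral_const_mul,
    circleIntegral.integral_const_mul, circleIntegral_sub_inv_pow_of_two_le c a R le_rfl,
    circleIntegral_sub_inv_pow_of_two_le c a R (by norm_num)]
  · ring
  · exact (continuousOn_const.mul (hca.pow 2)).circleIntegrable hR
  · exact (continuousOn_const.mul (hca.pow 3)).circleIntegrable hR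

/-- A simple pole at `a` times a double pole at `b ≠ a`, integrated by partial fractions. -/
lemma circleIntegral_one_add_mul_sub_inv_mul_sq {c a b : ℂ} {R : ℝ} (hR : 0 ≤ R)
    (ha : a ∉ sphere c R) (hb : b ∉ sphere c R) (hab : a ≠ b) :
    (∮ z in C(c, R), (1 + a * (z - a)⁻¹) * (b * (z - b)⁻¹) ^ 2) =
      a * b ^ 2 / (a - b) ^ 2 *
        ((∮ z in C(c, R), (z - a)⁻¹) - ∮ z in C(c, R), (z - b)⁻¹) := by
  have hca := continuousOn_sphere_sub_inv ha
  have hcb := continuousOn_sphere_sub_inv hb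
  have hexp : Set.EqOn (fun z : ℂ => (1 + a * (z - a)⁻¹) * (b * (z - b)⁻¹) ^ 2)
      (fun z => a * b ^ 2 / (a - b) ^ 2 * ((z - a)⁻¹ - (z - b)⁻¹) +
        (b ^ 2 - a * b ^ 2 / (a - b)) * ((z - b)⁻¹) ^ 2) (sphere c R) := by
    intro z hz
    have hza : z - a ≠ 0 := fun h => ha (sub_eq_zero.mp h ▸ hz)
    have hzb : z - b ≠ 0 := fun h => hb (sub_eq_zero.mp h ▸ hz)
    have hd : a - b ≠ 0 := sub_ne_zero.mpr hab
    simp only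
    field_simp
    ring
  rw [circleIntegral.integral_congr hR hexp, circleIntegral.integral_add,
    circleIntegral.integral_const_mul, circleIntegral.integral_const_mul,
    circleIntegral_sub_inv_pow_of_two_le c b R le_rfl,
    circleIntegral.integral_sub (hca.circleIntegrable hR) (hcb.circleIntegrable hR)]
  · ring
  · exact (continuousOn_const.mul (hca.sub hcb)).circleIntegrable hR
  · exact (continuousOn_const.mul (hcb.pow 2)).circleIntegrable hR

/-- Collecting a double sum of partial-fraction coefficients by poles. -/
lemma sum_sum_erase_mul_sq_div_sub_sq {ι : Type*} [Fintype ι] [DecidableEq ι]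
    {a : ι → ℂ} (ha : Function.Injective a) (J : ι → ℂ) :
    ∑ i, ∑ r ∈ Finset.univ.erase i, a i * a r ^ 2 / (a i - a r) ^ 2 * (J i - J r) =
      -∑ i, J i * (a i * ∑ r ∈ Finset.univ.erase i, a r / (a i - a r)) := by
  have hswap : ∑ i, ∑ r ∈ Finset.univ.erase i, a i * a r ^ 2 / (a i - a r) ^ 2 * J r =
      ∑ i, ∑ r ∈ Finset.univ.erase i, a r * a i ^ 2 / (a r - a i) ^ 2 * J i :=
    Finset.sum_comm' (by simp [eq_comm])
  simp_rw [mul_sub, Finset.sum_sub_distrib]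
  rw [hswap, ← Finset.sum_sub_distrib, ← Finset.sum_neg_distrib]
  refine Finset.sum_congr rfl fun i _ => ?_
  rw [← Finset.sum_sub_distrib, Finset.mul_sum, Finset.mul_sum, ← Finset.sum_neg_distrib]
  refine Finset.sum_congr rfl fun r hr => ?_
  have hd : a i - a r ≠ 0 :=
    sub_ne_zero.mpr (ha.ne (Finset.ne_of_mem_erase hr).symm)
  rw [← neg_sub (a i) (a r), neg_sq]
  field_simp
  ring

/-- The integral of a product of a sum of simple poles and a sum of double poles, in terms of the
integrals of the Cauchy kernels. -/
lemma circleIntegral_sum_mul_add_sum_sq {ι : Type*} [Fintype ι] [DecidableEq ι]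
    {a : ι → ℂ} (hinj : Function.Injective a) {c : ℂ} {R : ℝ} (hR : 0 ≤ R)
    (ha : ∀ i, a i ∉ sphere c R) (p q : ℂ) :
    (∮ z in C(c, R), (∑ i, (1 + a i * (z - a i)⁻¹)) *
        (p + q * ∑ r, (a r * (z - a r)⁻¹) ^ 2)) =
      ∑ i, (∮ z in C(c, R), (z - a i)⁻¹) *
        (a i * (p - q * ∑ r ∈ Finset.univ.erase i, a r / (a i - a r))) := by
  have hs : ∀ i, ContinuousOn (fun z : ℂ => 1 + a i * (z - a i)⁻¹) (sphere c R) := fun i =>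
    continuousOn_const.add (continuousOn_const.mul (continuousOn_sphere_sub_inv (ha i)))
  have hd : ∀ i r, ContinuousOn
      (fun z : ℂ => (1 + a i * (z - a i)⁻¹) * (a r * (z - a r)⁻¹) ^ 2) (sphere c R) :=
    fun i r => (hs i).mul
      ((continuousOn_const.mul (continuousOn_sphere_sub_inv (ha r))).pow 2)
  have hexp : ∀ z : ℂ, (∑ i, (1 + a i * (z - a i)⁻¹)) *
        (p + q * ∑ r, (a r * (z - a r)⁻¹) ^ 2) =
      p * (∑ i, (1 + a i * (z - a i)⁻¹)) +
        q * ∑ i, ∑ r, (1 + a i * (z - a i)⁻¹) * (a r * (z - a r)⁻¹) ^ 2 := fun z => by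
    rw [← Finset.sum_mul_sum]
    ring
  simp_rw [hexp]
  have hadd := circleIntegral.integral_add
    (f := fun z => p * ∑ i, (1 + a i * (z - a i)⁻¹))
    (g := fun z => q * ∑ i, ∑ r, (1 + a i * (z - a i)⁻¹) * (a r * (z - a r)⁻¹) ^ 2)
    ((continuousOn_const.mul (continuousOn_finsetSum _ fun i _ => hs i)).circleIntegrable hR)
    ((continuousOn_const.mul (continuousOn_finsetSum _ fun i _ =>
      continuousOn_finsetSum _ fun r _ => hd i r)).circleIntegrable hR)
  rw [hadd,
    circleIntegral.integral_const_mul, circleIntegral.integral_const_mul,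
    circleIntegral.integral_fun_sum fun i _ => (hs i).circleIntegrable hR,
    circleIntegral.integral_fun_sum fun i _ =>
      (continuousOn_finsetSum _ fun r _ => hd i r).circleIntegrable hR]
  have hinner : ∀ i, (∮ z in C(c, R), ∑ r, (1 + a i * (z - a i)⁻¹) * (a r * (z - a r)⁻¹) ^ 2) =
      ∑ r ∈ Finset.univ.erase i, a i * a r ^ 2 / (a i - a r) ^ 2 *
        ((∮ z in C(c, R), (z - a i)⁻¹) - ∮ z in C(c, R), (z - a r)⁻¹) := fun i => by
    rw [circleIntegral.integral_fun_sum fun r _ => (hd i r).circleIntegrable hR,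
      ← Finset.add_sum_erase _ _ (Finset.mem_univ i),
      circleIntegral_one_add_mul_sub_inv_mul_sq_self hR (ha i), zero_add]
    exact Finset.sum_congr rfl fun r hr => circleIntegral_one_add_mul_sub_inv_mul_sq hR
      (ha i) (ha r) (hinj.ne (Finset.ne_of_mem_erase hr).symm)
  simp_rw [hinner, fun i => circleIntegral_one_add_mul_sub_inv hR (ha i)]
  rw [sum_sum_erase_mul_sq_div_sub_sq hinj, mul_neg, ← sub_eq_add_neg, Finset.mul_sum,
    Finset.mul_sum, ← Finset.sum_sub_distrib]
  exact Finset.sum_congr rfl fun i _ => by ring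

/-- Proof of Theorem 4 of the paper: equality of the contour-integral form (44) of the proposed
eigenvalue estimator (times `|𝒩|`) and its closed form (26) (times `|𝒩|`), where the positively
oriented circle `C(x₀, R)` encloses exactly the sample eigenvalues `ρ̂_k`, `k ∈ 𝒩`. -/
theorem contour_integral_estimator_closed_form
    (N K : ℕ) (hN : 0 < N) (hK : 0 < K)
    (ρ : Fin N → ℝ) (hρ : ∀ i, 0 < ρ i) (hinj : Function.Injective ρ)
    (𝒩 : Finset (Fin N)) (h𝒩 : 𝒩.Nonempty)
    (x₀ R : ℝ) (hR : 0 < R)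
    (hin : ∀ k ∈ 𝒩, |ρ k - x₀| < R) (hout : ∀ i ∉ 𝒩, R < |ρ i - x₀|) :
    ((N : ℂ) / (2 * (π : ℂ) * Complex.I)) *
        (∮ z in C((x₀ : ℂ), R),
          -((1 / (N : ℂ)) * ∑ i, z / ((ρ i : ℂ) - z)) *
            (1 - (N : ℂ) / (K : ℂ) +
              ((N : ℂ) / (K : ℂ)) / (N : ℂ) * ∑ r, ((ρ r : ℂ) / ((ρ r : ℂ) - z)) ^ 2)) =
      ∑ k ∈ 𝒩, (ρ k : ℂ) *
        (1 - (N : ℂ) / (K : ℂ) -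
          ((N : ℂ) / (K : ℂ)) / (N : ℂ) *
            ∑ i ∈ Finset.univ.erase k, (ρ i : ℂ) / ((ρ k : ℂ) - (ρ i : ℂ))) := by
  have hdist : ∀ i, dist (ρ i : ℂ) (x₀ : ℂ) = |ρ i - x₀| := fun i => by
    rw [Complex.dist_eq, ← Complex.ofReal_sub, Complex.norm_real, Real.norm_eq_abs]
  have hsphere : ∀ i, (ρ i : ℂ) ∉ sphere (x₀ : ℂ) R := fun i hi => by
    rw [mem_sphere, hdist] at hi
    by_cases h : i ∈ 𝒩
    · exact (hin i h).ne hi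
    · exact (hout i h).ne' hi
  have hkernel : ∀ i, (∮ z in C((x₀ : ℂ), R), (z - (ρ i : ℂ))⁻¹) =
      if i ∈ 𝒩 then 2 * (π : ℂ) * Complex.I else 0 := fun i => by
    split_ifs with h
    · exact circleIntegral.integral_sub_inv_of_mem_ball (by
        rw [mem_ball, hdist]; exact hin i h)
    · exact circleIntegral_sub_inv_of_notMem_closedBall hR.le (by
        rw [mem_closedBall, hdist, not_le]; exact hout i h)
  have hN' : (N : ℂ) ≠ 0 := Nat.cast_ne_zero.mpr hN.ne'
  have hsq : ∀ (z : ℂ) r, ((ρ r : ℂ) / ((ρ r : ℂ) - z)) ^ 2 =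
      ((ρ r : ℂ) * (z - (ρ r : ℂ))⁻¹) ^ 2 := fun z r => by
    rw [← div_eq_mul_inv, ← neg_sub z, div_neg, neg_sq]
  have hcongr : Set.EqOn
      (fun z : ℂ => -((1 / (N : ℂ)) * ∑ i, z / ((ρ i : ℂ) - z)) *
        (1 - (N : ℂ) / (K : ℂ) +
          ((N : ℂ) / (K : ℂ)) / (N : ℂ) * ∑ r, ((ρ r : ℂ) / ((ρ r : ℂ) - z)) ^ 2))
      (fun z => (1 / (N : ℂ)) * ((∑ i, (1 + (ρ i : ℂ) * (z - (ρ i : ℂ))⁻¹)) *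
        (1 - (N : ℂ) / (K : ℂ) +
          ((N : ℂ) / (K : ℂ)) / (N : ℂ) * ∑ r, ((ρ r : ℂ) * (z - (ρ r : ℂ))⁻¹) ^ 2)))
      (sphere (x₀ : ℂ) R) := by
    intro z hz
    have hsum : ∑ i, z / ((ρ i : ℂ) - z) = -∑ i, (1 + (ρ i : ℂ) * (z - (ρ i : ℂ))⁻¹) := by
      rw [← Finset.sum_neg_distrib]
      refine Finset.sum_congr rfl fun i _ => ?_
      have hzi : z - (ρ i : ℂ) ≠ 0 := fun h => hsphere i (sub_eq_zero.mp h ▸ hz)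
      rw [← neg_sub z, div_neg]
      field_simp
      ring
    simp only [hsq, hsum]
    ring
  rw [circleIntegral.integral_congr hR.le hcongr, circleIntegral.integral_const_mul,
    circleIntegral_sum_mul_add_sum_sq (a := fun i => (ρ i : ℂ))
      (Complex.ofReal_injective.comp hinj) hR.le hsphere]
  simp only [hkernel, ite_mul, zero_mul, Finset.sum_ite_mem,
    Finset.univ_inter]
  rw [← Finset.mul_sum]
  have hcancel : (N : ℂ) / (2 * (π : ℂ) * Complex.I) * (1 / (N : ℂ)) *
      (2 * (π : ℂ) * Complex.I) = 1 := by
    have hpi := Complex.two_pi_I_ne_zero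
    generalize 2 * (π : ℂ) * Complex.I = t at hpi ⊢
    field_simp
  rw [← mul_assoc, ← mul_assoc, hcancel, one_mul]
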